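/- arXiv:1310.5671 — 2 statements merged into one kernel-verified Lean document; each statement's English description precedes it below -/
import Mathlib

section
/- For j = 1, 2, let M_j ⊆ ℂ^{n_j} be a closed set which is a Carleman continuum, and assume each M_j has the following approximation property: for every compact set K ⊆ ℂ^{n_j} with K ∪ M_j polynomially convex, every continuous function on K ∪ M_j that is holomorphic on an open neighborhood of K, and every continuous ε : K ∪ M_j → (0,∞), there is an entire function g on ℂ^{n_j} with |g − f| < ε on K ∪ M_j. Then the product M₁ × M₂ ⊆ ℂ^{n₁} × ℂ^{n₂} = ℂ^{n₁+n₂} has bounded E-hulls: for every compact set K ⊆ ℂ^{n₁+n₂}, the set h(K ∪ (M₁ × M₂)) is bounded. -/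
open Set

noncomputable section

/-- Polynomial hull of a compact set `C ⊆ ℂⁿ`. -/
def polyHullCompact {n : ℕ} (C : Set (Fin n → ℂ)) : Set (Fin n → ℂ) :=
  {z | ∀ p : MvPolynomial (Fin n) ℂ,
    ‖MvPolynomial.eval z p‖ ≤ sSup ((fun w => ‖MvPolynomial.eval w p‖) '' C)}

/-- Polynomial hull of a closed set `X ⊆ ℂⁿ`: union of hulls of compact subsets. -/
def polyHull {n : ℕ} (X : Set (Fin n → ℂ)) : Set (Fin n → ℂ) :=
  ⋃ C ∈ {C : Set (Fin n → ℂ) | IsCompact C ∧ C ⊆ X}, polyHullCompact C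

/-- `h(X) = X̂ \ X`. -/
def hHull {n : ℕ} (X : Set (Fin n → ℂ)) : Set (Fin n → ℂ) := polyHull X \ X

/-- A closed set `X` is polynomially convex if `h(X) = ∅`. -/
def IsPolyConvex {n : ℕ} (X : Set (Fin n → ℂ)) : Prop := hHull X = ∅

/-- `M` has bounded E-hulls if `h(K ∪ M)` is bounded for every compact `K`. -/
def HasBoundedEHulls {n : ℕ} (M : Set (Fin n → ℂ)) : Prop :=
  ∀ K : Set (Fin n → ℂ), IsCompact K → Bornology.IsBounded (hHull (K ∪ M))

/-- `M` is a Carleman continuum: entire functions approximate continuous functions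
on `M` in the Whitney `C⁰` topology. -/
def IsCarleman {n : ℕ} (M : Set (Fin n → ℂ)) : Prop :=
  ∀ f : (Fin n → ℂ) → ℂ, ContinuousOn f M →
  ∀ ε : (Fin n → ℂ) → ℝ, ContinuousOn ε M → (∀ x ∈ M, 0 < ε x) →
  ∃ g : (Fin n → ℂ) → ℂ, Differentiable ℂ g ∧ ∀ x ∈ M, ‖g x - f x‖ < ε x

/-- The product of `M₁ ⊆ ℂ^{n₁}` and `M₂ ⊆ ℂ^{n₂}` viewed inside `ℂ^{n₁+n₂}`
via the standard identification `ℂ^{n₁} × ℂ^{n₂} = ℂ^{n₁+n₂}`. -/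
def prodSet {n₁ n₂ : ℕ} (M₁ : Set (Fin n₁ → ℂ)) (M₂ : Set (Fin n₂ → ℂ)) :
    Set (Fin (n₁ + n₂) → ℂ) :=
  {z | (fun i => z (Fin.castAdd n₂ i)) ∈ M₁ ∧ (fun i => z (Fin.natAdd n₁ i)) ∈ M₂}

/-- The approximation property of Theorem 3: Carleman approximation of functions
continuous on `K ∪ M` and holomorphic near `K`, whenever `K ∪ M` is polynomially convex. -/
def ApproxProp {n : ℕ} (M : Set (Fin n → ℂ)) : Prop :=
  ∀ K : Set (Fin n → ℂ), IsCompact K → IsPolyConvex (K ∪ M) →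
  ∀ f : (Fin n → ℂ) → ℂ, ContinuousOn f (K ∪ M) →
  (∃ U : Set (Fin n → ℂ), IsOpen U ∧ K ⊆ U ∧ DifferentiableOn ℂ f U) →
  ∀ ε : (Fin n → ℂ) → ℝ, ContinuousOn ε (K ∪ M) → (∀ x ∈ K ∪ M, 0 < ε x) →
  ∃ g : (Fin n → ℂ) → ℂ, Differentiable ℂ g ∧ ∀ x ∈ K ∪ M, ‖g x - f x‖ < ε x

/-- The algebra homomorphism restricting polynomials to a set. -/
def polyRestrict {n : ℕ} (X : Set (Fin n → ℂ)) : MvPolynomial (Fin n) ℂ →ₐ[ℂ] C(X, ℂ) :=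
  MvPolynomial.aeval fun i => ⟨fun w => w.1 i, (continuous_apply i).comp continuous_subtype_val⟩

theorem polyRestrict_apply {n : ℕ} (X : Set (Fin n → ℂ)) (p : MvPolynomial (Fin n) ℂ) (w : X) :
    polyRestrict X p w = MvPolynomial.eval w.1 p := by
  induction p using MvPolynomial.induction_on with
  | C a => simp [polyRestrict]
  | add p q hp hq => simp [hp, hq]
  | mul_X p i hp => simp [hp]; simp [polyRestrict]

theorem exists_inv_mem_closure_polyRestrict {n : ℕ} {X : Set (Fin n → ℂ)} [CompactSpace X]
    (i : Fin n) (ζ : ℂ) (hζ : ∀ w ∈ X, ‖w i‖ < ‖ζ‖) (hζ0 : ζ ≠ 0) :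
    ∃ u ∈ (polyRestrict X).range.topologicalClosure, ∀ w : X, u w = (ζ - w.1 i)⁻¹ := by
  set A := (polyRestrict X).range.topologicalClosure
  set v : C(X, ℂ) := ζ⁻¹ • polyRestrict X (MvPolynomial.X i) with hv
  have hvA : v ∈ A :=
    A.smul_mem (Subalgebra.le_topologicalClosure _ ⟨_, rfl⟩) _
  have hv1 : ‖v‖ < 1 := by
    rw [ContinuousMap.norm_lt_iff _ one_pos]
    intro w
    have := hζ w.1 w.2
    simp only [hv, ContinuousMap.smul_apply, polyRestrict_apply, MvPolynomial.eval_X, norm_smul,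
      norm_inv]
    rw [inv_mul_lt_iff₀ (norm_pos_iff.2 hζ0)]
    simpa using this
  have hS := summable_geometric_of_norm_lt_one hv1
  have hSA : ∑' m : ℕ, v ^ m ∈ A :=
    (Subalgebra.isClosed_topologicalClosure _).mem_of_tendsto hS.hasSum
      (Filter.Eventually.of_forall fun s => A.sum_mem fun m _ => A.pow_mem hvA m)
  refine ⟨ζ⁻¹ • ∑' m : ℕ, v ^ m, A.smul_mem hSA _, fun w => ?_⟩
  have h := DFunLike.congr_fun (mul_neg_geom_series v hv1) w
  have hne : ζ - w.1 i ≠ 0 := by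
    intro h0
    exact (hζ w.1 w.2).ne (by rw [sub_eq_zero.1 h0])
  simp only [hv, ContinuousMap.mul_apply, ContinuousMap.sub_apply, ContinuousMap.one_apply,
    ContinuousMap.smul_apply, polyRestrict_apply, MvPolynomial.eval_X] at h
  rw [ContinuousMap.smul_apply, eq_inv_of_mul_eq_one_right h]
  simp only [smul_eq_mul]
  field_simp

theorem restrict_mem_closure_polyRestrict {n : ℕ} {X : Set (Fin n → ℂ)} [CompactSpace X]
    (S : Finset (Fin n)) :
    ∀ f : (Fin n → ℂ) → ℂ, Differentiable ℂ f → (∀ w w', (∀ i ∈ S, w i = w' i) → f w = f w') →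
    ∀ F : C(X, ℂ), (∀ w : X, F w = f w.1) → F ∈ (polyRestrict X).range.topologicalClosure := by
  have hX : IsCompact X := isCompact_iff_compactSpace.2 inferInstance
  set A := (polyRestrict X).range.topologicalClosure with hA
  induction S using Finset.induction_on with
  | empty =>
    intro f _ hf F hF
    have : F = algebraMap ℂ C(X, ℂ) (f 0) := by
      ext w
      rw [hF, hf w.1 0 (by simp)]
      simp [Algebra.algebraMap_eq_smul_one]
    rw [this]
    exact A.algebraMap_mem _
  | insert i S hi ih =>
    intro f hfd hf F hF
    obtain ⟨R, hRpos, hR⟩ := hX.isBounded.exists_pos_norm_lt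
    have hcirc : ∀ θ : ℝ, ‖circleMap 0 R θ‖ = R := by simp [abs_of_pos hRpos]
    have hwi : ∀ w ∈ X, ‖w i‖ < R := fun w hw => (norm_le_pi_norm w i).trans_lt (hR w hw)
    have hne : ∀ (θ : ℝ), ∀ w ∈ X, circleMap 0 R θ - w i ≠ 0 := by
      intro θ w hw h0
      have := hwi w hw
      rw [← sub_eq_zero.1 h0, hcirc] at this
      exact this.false
    have hfc := hfd.continuous
    have hci : ∀ j : Fin n, Continuous fun w : X => w.1 j := fun j =>
      (continuous_apply j).comp continuous_subtype_val
    let G : ℝ → C(X, ℂ) := fun θ =>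
      ⟨fun w => (circleMap 0 R θ - w.1 i)⁻¹ * f (Function.update w.1 i (circleMap 0 R θ)), by
        refine Continuous.mul (Continuous.inv₀ (continuous_const.sub (hci i)) fun w => hne θ w.1 w.2) ?_
        exact hfc.comp (by fun_prop)⟩
    have hGA : ∀ θ, G θ ∈ A := by
      intro θ
      obtain ⟨u, huA, hu⟩ := exists_inv_mem_closure_polyRestrict (X := X) i (circleMap 0 R θ)
        (fun w hw => by rw [hcirc]; exact hwi w hw)
        (by rw [← norm_pos_iff, hcirc]; exact hRpos)
      have h2 := ih (fun w => f (Function.update w i (circleMap 0 R θ)))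
        (hfd.comp (by
          rw [differentiable_pi]
          intro j
          rcases eq_or_ne j i with rfl | hj
          · simp
          · simp only [Function.update_of_ne hj]; fun_prop))
        (fun w w' hww => hf _ _ (by
          intro j hj
          rcases eq_or_ne j i with rfl | hji
          · simp
          · simp only [Function.update_of_ne hji]
            exact hww j ((Finset.mem_insert.1 hj).resolve_left hji)))
        ⟨fun w => f (Function.update w.1 i (circleMap 0 R θ)), hfc.comp (by fun_prop)⟩
        (fun w => rfl)
      have : G θ = u * ⟨fun w => f (Function.update w.1 i (circleMap 0 R θ)),
          hfc.comp (by fun_prop)⟩ := by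
        ext w
        simp [G, hu]
      rw [this]
      exact A.mul_mem huA h2
    have hGc : Continuous G := by
      refine ContinuousMap.continuous_of_continuous_uncurry _ ?_
      refine Continuous.mul (Continuous.inv₀ (f := fun q : ℝ × X => circleMap 0 R q.1 - q.2.1 i)
        ?_ fun w => hne _ _ w.2.2) ?_
      · exact ((continuous_circleMap 0 R).comp continuous_fst).sub ((hci i).comp continuous_snd)
      · have := continuous_circleMap 0 R
        refine hfc.comp (f := fun q : ℝ × X => Function.update q.2.1 i (circleMap 0 R q.1)) ?_
        fun_prop
    let B : Submodule ℂ C(X, ℂ) := Subalgebra.toSubmodule A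
    have hBc : IsClosed (B : Set C(X, ℂ)) := Subalgebra.isClosed_topologicalClosure _
    have : CompleteSpace B := hBc.completeSpace_coe
    let H : ℝ → B := fun θ => deriv (circleMap 0 R) θ • (⟨G θ, hGA θ⟩ : B)
    have hHc : Continuous H := by
      have h1 : Continuous fun θ => (⟨G θ, hGA θ⟩ : B) := hGc.subtype_mk _
      have h2 : Continuous (deriv (circleMap 0 R)) := by
        have : deriv (circleMap 0 R) = fun θ => circleMap 0 R θ * Complex.I := by
          ext θ; simp
        rw [this]
        have := continuous_circleMap 0 R
        fun_prop
      exact h2.smul h1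
    have key : F = (2 * Real.pi * Complex.I : ℂ)⁻¹ •
        ((∫ θ in (0 : ℝ)..2 * Real.pi, H θ : B) : C(X, ℂ)) := by
      ext w
      have hcau :=
        Complex.two_pi_I_inv_smul_circleIntegral_sub_inv_smul_of_differentiable_on_off_countable
        (R := R) (c := 0) (w := w.1 i) (f := fun ζ => f (Function.update w.1 i ζ)) (s := ∅)
        countable_empty (by simpa using hwi w.1 w.2)
        (hfc.comp (by fun_prop)).continuousOn
        (fun x _ => (hfd.comp (by
          rw [differentiable_pi]
          intro j
          rcases eq_or_ne j i with rfl | hj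
          · simp
          · simp only [Function.update_of_ne hj]; fun_prop)) x)
      rw [Function.update_eq_self, ← hF] at hcau
      rw [← hcau]
      have hcomm := ((ContinuousMap.evalCLM ℂ w).comp B.subtypeL).intervalIntegral_comp_comm
        (hHc.intervalIntegrable (μ := MeasureTheory.volume) 0 (2 * Real.pi))
      rw [ContinuousMap.smul_apply]
      congr 1
    rw [key]
    exact A.smul_mem (Subtype.mem _) _

/-- Entire functions are uniform limits of polynomials on compact sets. -/
theorem exists_polynomial_near_entire {n : ℕ} {X : Set (Fin n → ℂ)} (hX : IsCompact X)
    {f : (Fin n → ℂ) → ℂ} (hf : Differentiable ℂ f) {δ : ℝ} (hδ : 0 < δ) :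
    ∃ p : MvPolynomial (Fin n) ℂ, ∀ w ∈ X, ‖MvPolynomial.eval w p - f w‖ < δ := by
  have : CompactSpace X := isCompact_iff_compactSpace.1 hX
  have h := restrict_mem_closure_polyRestrict (X := X) Finset.univ f hf
    (fun w w' h => by rw [funext fun i => h i (Finset.mem_univ i)])
    ⟨fun w => f w.1, hf.continuous.comp continuous_subtype_val⟩ fun w => rfl
  rw [← SetLike.mem_coe, Subalgebra.topologicalClosure_coe, Metric.mem_closure_iff] at h
  obtain ⟨_, ⟨p, rfl⟩, hp⟩ := h δ hδ
  refine ⟨p, fun w hw => ?_⟩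
  rw [dist_comm, dist_eq_norm] at hp
  have := (ContinuousMap.norm_lt_iff _ hδ).1 hp ⟨w, hw⟩
  rw [ContinuousMap.sub_apply] at this
  erw [polyRestrict_apply] at this
  exact this

theorem differentiable_eval {n : ℕ} (p : MvPolynomial (Fin n) ℂ) :
    Differentiable ℂ fun w : Fin n → ℂ => MvPolynomial.eval w p := by
  induction p using MvPolynomial.induction_on with
  | C a => simp
  | add p q hp hq => simp only [map_add]; exact hp.add hq
  | mul_X p i hp =>
    simp only [map_mul, MvPolynomial.eval_X]
    exact hp.mul (differentiable_apply i)

theorem mem_polyHullCompact_iff {n : ℕ} {X : Set (Fin n → ℂ)} (hX : IsCompact X)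
    {z : Fin n → ℂ} : z ∈ polyHullCompact X ↔ ∀ (p : MvPolynomial (Fin n) ℂ) (c : ℝ), 0 ≤ c →
      (∀ w ∈ X, ‖MvPolynomial.eval w p‖ ≤ c) → ‖MvPolynomial.eval z p‖ ≤ c := by
  constructor
  · intro hz p c hc h
    refine (hz p).trans (Real.sSup_le ?_ hc)
    rintro _ ⟨w, hw, rfl⟩
    exact h w hw
  · intro h p
    refine h p _ (Real.sSup_nonneg ?_) fun w hw => le_csSup ?_ ⟨w, hw, rfl⟩
    · rintro _ ⟨w, _, rfl⟩
      exact norm_nonneg _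
    · exact hX.bddAbove_image (MvPolynomial.continuous_eval p).norm.continuousOn

theorem polyHullCompact_mono {n : ℕ} {X Y : Set (Fin n → ℂ)} (hX : IsCompact X)
    (hY : IsCompact Y) (h : X ⊆ Y) : polyHullCompact X ⊆ polyHullCompact Y := fun _ hz =>
  (mem_polyHullCompact_iff hY).2 fun p c hc hp =>
    (mem_polyHullCompact_iff hX).1 hz p c hc fun w hw => hp w (h hw)

theorem subset_polyHullCompact {n : ℕ} {X : Set (Fin n → ℂ)} (hX : IsCompact X) :
    X ⊆ polyHullCompact X := fun z hz =>
  (mem_polyHullCompact_iff hX).2 fun _ _ _ h => h z hz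

theorem isCompact_polyHullCompact {n : ℕ} {X : Set (Fin n → ℂ)} (hX : IsCompact X) :
    IsCompact (polyHullCompact X) := by
  refine Metric.isCompact_of_isClosed_isBounded ?_ ?_
  · simp only [polyHullCompact, ofPred_forall]
    exact isClosed_iInter fun p =>
      isClosed_le (MvPolynomial.continuous_eval p).norm continuous_const
  · obtain ⟨R, hRpos, hR⟩ := hX.isBounded.exists_pos_norm_le
    refine (Metric.isBounded_closedBall (x := 0) (r := R)).subset fun z hz => ?_
    rw [mem_closedBall_zero_iff, pi_norm_le_iff_of_nonneg hRpos.le]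
    intro i
    simpa using (mem_polyHullCompact_iff hX).1 hz (MvPolynomial.X i) R hRpos.le
      fun w hw => by simpa using (norm_le_pi_norm w i).trans (hR w hw)

theorem norm_le_of_mem_polyHullCompact {n : ℕ} {X : Set (Fin n → ℂ)} (hX : IsCompact X)
    {z : Fin n → ℂ} (hz : z ∈ polyHullCompact X) {f : (Fin n → ℂ) → ℂ}
    (hf : Differentiable ℂ f) {c : ℝ} (hc : 0 ≤ c) (h : ∀ w ∈ X, ‖f w‖ ≤ c) : ‖f z‖ ≤ c := by
  refine le_of_forall_pos_le_add fun δ hδ => ?_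
  obtain ⟨p, hp⟩ := exists_polynomial_near_entire (hX.insert z) hf (half_pos hδ)
  have h1 : ‖MvPolynomial.eval z p‖ ≤ c + δ / 2 := by
    refine (mem_polyHullCompact_iff hX).1 hz p _ (by positivity) fun w hw => ?_
    have h2 := hp w (mem_insert_of_mem _ hw)
    have h3 := norm_le_norm_add_norm_sub' (MvPolynomial.eval w p) (f w)
    linarith [h w hw]
  have h2 := hp z (mem_insert _ _)
  have h3 := norm_le_norm_add_norm_sub (MvPolynomial.eval z p) (f z)
  linarith

theorem map_mem_polyHullCompact {m n : ℕ} {X : Set (Fin m → ℂ)} (hX : IsCompact X)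
    {z : Fin m → ℂ} (hz : z ∈ polyHullCompact X) {π : (Fin m → ℂ) → (Fin n → ℂ)}
    (hπ : Differentiable ℂ π) : π z ∈ polyHullCompact (π '' X) := by
  refine (mem_polyHullCompact_iff (hX.image hπ.continuous)).2 fun p c hc h => ?_
  exact norm_le_of_mem_polyHullCompact hX hz ((differentiable_eval p).comp hπ) hc fun w hw =>
    h _ (mem_image_of_mem π hw)

/-- A norm-decreasing extension of evaluation at a point of the hull of `X`. -/
theorem exists_evaluation_extension {n : ℕ} {X : Set (Fin n → ℂ)} (hX : IsCompact X)
    {z : Fin n → ℂ} (hz : z ∈ polyHullCompact X) :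
    ∃ L : C(Fin n → ℂ, ℂ) →ₗ[ℂ] ℂ,
      (∀ (f : C(Fin n → ℂ, ℂ)) (c : ℝ), 0 ≤ c → (∀ w ∈ X, ‖f w‖ ≤ c) → ‖L f‖ ≤ c) ∧
      ∀ f : C(Fin n → ℂ, ℂ), Differentiable ℂ f → L f = f z := by
  have : CompactSpace X := isCompact_iff_compactSpace.1 hX
  let e : MvPolynomial (Fin n) ℂ →ₗ[ℂ] C(X, ℂ) := (polyRestrict X).toLinearMap
  have he : ∀ p, ‖MvPolynomial.eval z p‖ ≤ ‖e p‖ := fun p =>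
    (mem_polyHullCompact_iff hX).1 hz p _ (norm_nonneg _) fun w hw => by
      rw [← polyRestrict_apply X p ⟨w, hw⟩]
      exact ContinuousMap.norm_coe_le_norm (polyRestrict X p) _
  obtain ⟨s, hs⟩ := e.rangeRestrict.exists_rightInverse_of_surjective e.range_rangeRestrict
  have hs' : ∀ x, e (s x) = x := fun x => congrArg Subtype.val (DFunLike.congr_fun hs x)
  let Λ₀ : LinearMap.range e →ₗ[ℂ] ℂ := (MvPolynomial.aeval z).toLinearMap.comp s
  have hΛ₀ : ∀ x, Λ₀ x = MvPolynomial.eval z (s x) := fun x => by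
    simp [Λ₀]
  obtain ⟨Λ, hΛ, hΛn⟩ := exists_extension_norm_eq (LinearMap.range e)
    (Λ₀.mkContinuous 1 fun x => by
      rw [hΛ₀, one_mul]
      exact (he _).trans (by rw [hs']; rfl))
  have hΛ1 : ‖Λ‖ ≤ 1 := hΛn ▸ LinearMap.mkContinuous_norm_le _ zero_le_one _
  have hΛp : ∀ p, Λ (e p) = MvPolynomial.eval z p := fun p => by
    have h1 := hΛ ⟨e p, p, rfl⟩
    rw [LinearMap.mkContinuous_apply, hΛ₀] at h1
    rw [h1, ← sub_eq_zero, ← map_sub, ← norm_le_zero_iff]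
    refine (he _).trans ?_
    rw [map_sub, hs', sub_self, norm_zero]
  let L : C(Fin n → ℂ, ℂ) →ₗ[ℂ] ℂ :=
    { toFun := fun f => Λ (f.restrict X)
      map_add' := fun f g => by rw [← map_add]; rfl
      map_smul' := fun a f => by rw [RingHom.id_apply, ← map_smul]; rfl }
  have hL : ∀ (f : C(Fin n → ℂ, ℂ)) (c : ℝ), 0 ≤ c → (∀ w ∈ X, ‖f w‖ ≤ c) → ‖L f‖ ≤ c := by
    intro f c hc h
    refine (Λ.le_of_opNorm_le hΛ1 _).trans ?_
    rw [one_mul, ContinuousMap.norm_le _ hc]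
    exact fun w => h w w.2
  refine ⟨L, hL, fun f hf => ?_⟩
  rw [← sub_eq_zero, ← norm_le_zero_iff]
  refine le_of_forall_pos_le_add fun δ hδ => ?_
  obtain ⟨p, hp⟩ := exists_polynomial_near_entire (hX.insert z) hf (half_pos hδ)
  let P : C(Fin n → ℂ, ℂ) := ⟨fun w => MvPolynomial.eval w p, MvPolynomial.continuous_eval p⟩
  have hLP : L P = MvPolynomial.eval z p := by
    rw [← hΛp]
    refine congrArg Λ ?_
    ext w
    exact (polyRestrict_apply X p w).symm
  have h1 : ‖L (P - f)‖ ≤ δ / 2 :=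
    hL _ _ (half_pos hδ).le fun w hw => (hp w (mem_insert_of_mem _ hw)).le
  rw [map_sub, hLP] at h1
  have h2 := hp z (mem_insert _ _)
  have h3 : L f - f z = (MvPolynomial.eval z p - f z) - (MvPolynomial.eval z p - L f) := by ring
  rw [h3]
  have h4 := norm_sub_le (MvPolynomial.eval z p - f z) (MvPolynomial.eval z p - L f)
  linarith

/-- The translated coordinate function `w ↦ w i - z i`. -/
def coordSub {n : ℕ} (z : Fin n → ℂ) (i : Fin n) : C(Fin n → ℂ, ℂ) :=
  ⟨fun w => w i - z i, by fun_prop⟩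

theorem sum_sub_mul_conj {n : ℕ} (w z : Fin n → ℂ) :
    ∑ i, (w i - z i) * (starRingEnd ℂ) (w i - z i) = ((∑ i, ‖w i - z i‖ ^ 2 : ℝ) : ℂ) := by
  push_cast
  exact Finset.sum_congr rfl fun i _ => Complex.mul_conj' _

theorem sum_norm_sub_sq_pos {n : ℕ} {w z : Fin n → ℂ} (h : w ≠ z) :
    0 < ∑ i, ‖w i - z i‖ ^ 2 := by
  obtain ⟨i, hi⟩ := Function.ne_iff.1 h
  have := norm_pos_iff.2 (sub_ne_zero.2 hi)
  exact Finset.sum_pos' (fun _ _ => by positivity) ⟨i, Finset.mem_univ _, by positivity⟩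

theorem exists_separating_functional {n : ℕ} {X Y : Set (Fin n → ℂ)} (hX : IsCompact X)
    (hY : IsCompact Y) {z : Fin n → ℂ} (hz : z ∈ polyHullCompact X) (hzX : z ∉ X)
    (hzY : z ∉ polyHullCompact Y) :
    ∃ (L : C(Fin n → ℂ, ℂ) →ₗ[ℂ] ℂ) (φ : Fin n → C(Fin n → ℂ, ℂ)),
      (∀ (f : C(Fin n → ℂ, ℂ)) (c : ℝ), 0 ≤ c → (∀ w ∈ X, ‖f w‖ ≤ c) → ‖L f‖ ≤ c) ∧
      (∀ f : C(Fin n → ℂ, ℂ), Differentiable ℂ f → L f = f z) ∧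
      (∀ i, ∀ w ∈ Y, φ i w = 0) ∧ L (∑ i, coordSub z i * φ i) ≠ 0 := by
  obtain ⟨L, hL, hLz⟩ := exists_evaluation_extension hX hz
  rw [mem_polyHullCompact_iff hY] at hzY
  push Not at hzY
  obtain ⟨p, c, hc, hpY, hpz⟩ := hzY
  obtain ⟨s, hcs, hsz⟩ := exists_between hpz
  have hs : 0 < s := hc.trans_lt hcs
  obtain ⟨d, hd, hdX⟩ := hX.exists_forall_le' (f := fun w => ∑ i, ‖w i - z i‖ ^ 2)
    (by fun_prop) (a := 0) fun w hw => sum_norm_sub_sq_pos fun h => hzX (by rwa [← h])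
  have hpc := MvPolynomial.continuous_eval p
  have hmax : ∀ w, (max s ‖MvPolynomial.eval w p‖) ≠ 0 := fun w => (lt_max_of_lt_left hs).ne'
  have hmaxd : ∀ w : Fin n → ℂ, (max d (∑ i, ‖w i - z i‖ ^ 2)) ≠ 0 :=
    fun w => (lt_max_of_lt_left hd).ne'
  let P : C(Fin n → ℂ, ℂ) := ⟨fun w => MvPolynomial.eval w p, hpc⟩
  let T : C(Fin n → ℂ, ℂ) :=
    ⟨fun w => ((s / max s ‖MvPolynomial.eval w p‖ : ℝ) : ℂ) * MvPolynomial.eval w p,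
      (Complex.continuous_ofReal.comp
        (continuous_const.div (continuous_const.max hpc.norm) hmax)).mul hpc⟩
  let D : Fin n → C(Fin n → ℂ, ℂ) := fun i =>
    ⟨fun w => (starRingEnd ℂ) (w i - z i) *
      (((max d (∑ i, ‖w i - z i‖ ^ 2))⁻¹ : ℝ) : ℂ), by
      refine Continuous.mul ?_ (Complex.continuous_ofReal.comp (Continuous.inv₀ ?_ hmaxd))
      · exact Complex.continuous_conj.comp (by fun_prop)
      · fun_prop⟩
  refine ⟨L, fun i => (P - T) * D i, hL, hLz, fun i w hw => ?_, ?_⟩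
  · have : (P - T) w = 0 := by
      have h1 : max s ‖MvPolynomial.eval w p‖ = s := max_eq_left ((hpY w hw).trans hcs.le)
      simp [P, T, h1, hs.ne']
    rw [ContinuousMap.mul_apply, this, zero_mul]
  · have hT : ‖L T‖ ≤ s := by
      refine hL _ _ hs.le fun w _ => ?_
      change ‖((s / max s ‖MvPolynomial.eval w p‖ : ℝ) : ℂ) * MvPolynomial.eval w p‖ ≤ s
      have h0 : 0 < max s ‖MvPolynomial.eval w p‖ := lt_max_of_lt_left hs
      rw [norm_mul, Complex.norm_real, Real.norm_of_nonneg (by positivity), div_mul_eq_mul_div,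
        div_le_iff₀ h0]
      exact mul_le_mul_of_nonneg_left (le_max_right _ _) hs.le
    have hP : L P = MvPolynomial.eval z p := hLz P (differentiable_eval p)
    have hsum : L (∑ i, coordSub z i * ((P - T) * D i)) = L (P - T) := by
      rw [← sub_eq_zero, ← map_sub, ← norm_le_zero_iff]
      refine hL _ _ le_rfl fun w hw => ?_
      rw [norm_le_zero_iff, ContinuousMap.sub_apply, sub_eq_zero, ContinuousMap.sum_apply]
      have h1 : ∀ i, (coordSub z i * ((P - T) * D i)) w = (P - T) w *
          (((w i - z i) * (starRingEnd ℂ) (w i - z i)) *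
          (((max d (∑ i, ‖w i - z i‖ ^ 2))⁻¹ : ℝ) : ℂ)) := fun i => by
        change (w i - z i) * ((P - T) w * ((starRingEnd ℂ) (w i - z i) * _)) = _
        ring
      have h2 := sum_norm_sub_sq_pos (w := w) (z := z) fun h => hzX (by rwa [← h])
      rw [Finset.sum_congr rfl fun i _ => h1 i, ← Finset.mul_sum, ← Finset.sum_mul,
        sum_sub_mul_conj, max_eq_right (hdX w hw), ← Complex.ofReal_mul, mul_inv_cancel₀ h2.ne']
      simp
    rw [hsum, map_sub, sub_ne_zero, hP]
    intro h
    rw [← h] at hT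
    exact absurd hsz (not_lt.2 hT)

theorem exists_triangular_coefficients (a : ℕ → ℕ → ℂ) (ha : ∀ j, a j j ≠ 0) (t : ℕ → ℝ) :
    ∃ c : ℕ → ℂ, ∀ j, t j < ‖∑ k ∈ Finset.range (j + 1), c k * a k j‖ := by
  have hstep : ∀ (j : ℕ) (β : ℂ), ∃ x : ℂ, t j < ‖β + x * a j j‖ := fun j β => by
    refine ⟨(((|t j| + 1 : ℝ) : ℂ) - β) / a j j, ?_⟩
    rw [div_mul_cancel₀ _ (ha j), add_sub_cancel, Complex.norm_real,
      Real.norm_of_nonneg (by positivity)]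
    exact (le_abs_self _).trans_lt (lt_add_one _)
  choose F hF using hstep
  let u : ℕ → ℕ → ℂ := fun m => Nat.rec 0
    (fun j v => Function.update v j (F j (∑ k ∈ Finset.range j, v k * a k j))) m
  have hu : ∀ j, u (j + 1) =
      Function.update (u j) j (F j (∑ k ∈ Finset.range j, u j k * a k j)) := fun j => rfl
  have hstable : ∀ k d, u (k + 1 + d) k = u (k + 1) k := by
    intro k d
    induction d with
    | zero => rfl
    | succ d ih =>
      rw [← add_assoc, hu, Function.update_of_ne (by omega), ih]
  refine ⟨fun k => u (k + 1) k, fun j => ?_⟩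
  have h1 : ∑ k ∈ Finset.range j, u (k + 1) k * a k j = ∑ k ∈ Finset.range j, u j k * a k j := by
    refine Finset.sum_congr rfl fun k hk => ?_
    obtain ⟨d, rfl⟩ := Nat.exists_eq_add_of_le (Nat.succ_le_of_lt (Finset.mem_range.1 hk))
    rw [hstable]
  beta_reduce
  rw [Finset.sum_range_succ, h1, hu, Function.update_self]
  exact hF _ _

theorem IsCarleman.exists_radius {n : ℕ} {M : Set (Fin n → ℂ)} (hM : IsCarleman M)
    (hMc : IsClosed M) {K : Set (Fin n → ℂ)} (hK : IsCompact K) :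
    ∃ R : ℕ, ∀ S : ℕ, polyHullCompact (K ∪ (M ∩ Metric.closedBall 0 S)) ⊆
      polyHullCompact (K ∪ (M ∩ Metric.closedBall 0 R)) ∪ M := by
  by_contra hcon
  push Not at hcon
  set X : ℕ → Set (Fin n → ℂ) := fun r => K ∪ (M ∩ Metric.closedBall 0 r) with hXdef
  have hXc : ∀ r, IsCompact (X r) := fun r =>
    hK.union ((isCompact_closedBall _ _).inter_left hMc)
  have hXmono : Monotone X := fun r s hrs =>
    union_subset_union_right _ (inter_subset_inter_right _
      (Metric.closedBall_subset_closedBall (Nat.cast_le.2 hrs)))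
  have hcon' : ∀ R : ℕ, ∃ S : ℕ, R < S ∧ ∃ z ∈ polyHullCompact (X S),
      z ∉ polyHullCompact (X R) ∧ z ∉ M := by
    intro R
    obtain ⟨S, hS⟩ := hcon R
    obtain ⟨z, hz, hz'⟩ := not_subset.1 hS
    rw [mem_union, not_or] at hz'
    exact ⟨max S (R + 1), lt_max_of_lt_right (Nat.lt_succ_self R), z,
      polyHullCompact_mono (hXc _) (hXc _) (hXmono (le_max_left _ _)) hz, hz'⟩
  choose T hT z' hz' hz'R hz'M using hcon'
  let ρ : ℕ → ℕ := fun j => T^[j] 0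
  have hρ : ∀ j, ρ (j + 1) = T (ρ j) := fun j => Function.iterate_succ_apply' T j 0
  have hρmono : StrictMono ρ := strictMono_nat_of_lt_succ fun j => by rw [hρ]; exact hT _
  have hρid : ∀ j, j ≤ ρ j := hρmono.id_le
  let z : ℕ → Fin n → ℂ := fun j => z' (ρ j)
  have hzX : ∀ j, z j ∉ X (ρ (j + 1)) := fun j h =>
    h.elim (fun h => hz'R _ (subset_polyHullCompact (hXc _) (Or.inl h))) fun h => hz'M _ h.1
  have hsep := fun j => exists_separating_functional (hXc (ρ (j + 1))) (hXc (ρ j))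
    (z := z j) (by rw [hρ]; exact hz' (ρ j)) (hzX j) (hz'R (ρ j))
  choose L φ hL hLz hφ hLφ using hsep
  have hb : ∀ j, ∃ b : ℝ, 0 ≤ b ∧ ∀ w ∈ X (ρ (j + 1)), ∀ i, ‖w i - z j i‖ ≤ b := by
    intro j
    obtain ⟨b, hb⟩ := (hXc (ρ (j + 1))).exists_bound_of_continuousOn (f := fun w => w - z j)
      (by fun_prop)
    exact ⟨max b 0, le_max_right _ _, fun w hw i =>
      (norm_le_pi_norm (w - z j) i).trans ((hb w hw).trans (le_max_left _ _))⟩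
  choose b hb0 hb using hb
  obtain ⟨c, hc⟩ := exists_triangular_coefficients
    (fun k j => L j (∑ i, coordSub (z j) i * φ k i)) hLφ (fun j => n * (b j * j))
  let f : Fin n → (Fin n → ℂ) → ℂ := fun i w => ∑' k, c k * φ k i w
  have hfsum : ∀ i m, ∀ w ∈ M, ‖w‖ ≤ ρ m → f i w = ∑ k ∈ Finset.range m, c k * φ k i w := by
    intro i m w hw hwm
    refine tsum_eq_sum fun k hk => ?_
    rw [hφ k i w (Or.inr ⟨hw, ?_⟩), mul_zero]
    rw [mem_closedBall_zero_iff]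
    exact hwm.trans (Nat.cast_le.2 (hρmono.monotone (not_lt.1 fun h => hk (Finset.mem_range.2 h))))
  have hfc : ∀ i, ContinuousOn (f i) M := by
    intro i x hx
    obtain ⟨m, hm⟩ := exists_nat_gt ‖x‖
    have hev : ∀ᶠ w in nhdsWithin x M, ‖w‖ < m :=
      nhdsWithin_le_nhds (continuous_norm.continuousAt.eventually_lt continuousAt_const hm)
    have hcont : Continuous fun w => ∑ k ∈ Finset.range m, c k * φ k i w := by fun_prop
    refine (hcont.continuousWithinAt (s := M) (x := x)).congr_of_eventuallyEq ?_
      (hfsum i m x hx (hm.le.trans (Nat.cast_le.2 (hρid m))))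
    filter_upwards [hev, self_mem_nhdsWithin] with w hw hwM
    exact hfsum i m w hwM (hw.le.trans (Nat.cast_le.2 (hρid m)))
  choose g hg hgf using fun i => hM (f i) (hfc i) (fun _ => 1) continuousOn_const
    fun _ _ => one_pos
  have hgc : ∀ i, Continuous (g i) := fun i => (hg i).continuous
  obtain ⟨A, hA⟩ := hK.exists_bound_of_continuousOn (f := fun w i => g i w)
    (continuous_pi hgc).continuousOn
  obtain ⟨J, hJ⟩ := exists_nat_ge (max 1 A)
  let gC : Fin n → C(Fin n → ℂ, ℂ) := fun i => ⟨g i, hgc i⟩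
  let F : Fin n → C(Fin n → ℂ, ℂ) := fun i => ∑ k ∈ Finset.range (J + 1), c k • φ k i
  have hFapp : ∀ i w, F i w = ∑ k ∈ Finset.range (J + 1), c k * φ k i w := fun i w => by
    simp [F, ContinuousMap.sum_apply]
  have hdiff : ∀ i, ∀ w ∈ X (ρ (J + 1)), ‖g i w - F i w‖ ≤ J := by
    rintro i w (hw | hw)
    · have h0 : F i w = 0 := by
        rw [hFapp]
        exact Finset.sum_eq_zero fun k _ => by rw [hφ k i w (Or.inl hw), mul_zero]
      rw [h0, sub_zero]
      exact (norm_le_pi_norm (fun i => g i w) i).trans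
        ((hA w hw).trans ((le_max_right _ _).trans hJ))
    · rw [hFapp, ← hfsum i (J + 1) w hw.1 (mem_closedBall_zero_iff.1 hw.2)]
      exact (hgf i w hw.1).le.trans ((le_max_left _ _).trans hJ)
  have hG : ‖L J (∑ i, coordSub (z J) i * (gC i - F i))‖ ≤ n * (b J * J) := by
    have := hb0 J
    refine hL J _ _ (by positivity) fun w hw => ?_
    rw [ContinuousMap.sum_apply]
    refine (norm_sum_le _ _).trans ?_
    calc ∑ i, ‖(coordSub (z J) i * (gC i - F i)) w‖ ≤ ∑ _i : Fin n, b J * J := by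
          refine Finset.sum_le_sum fun i _ => ?_
          rw [ContinuousMap.mul_apply, norm_mul]
          exact mul_le_mul (hb J w hw i) (hdiff i w hw) (norm_nonneg _) this
      _ = n * (b J * J) := by simp
  have hLg : L J (∑ i, coordSub (z J) i * gC i) = 0 := by
    rw [hLz J]
    · simp [ContinuousMap.sum_apply, coordSub]
    · have : ⇑(∑ i, coordSub (z J) i * gC i) = fun w => ∑ i, (w i - z J i) * g i w := by
        ext w
        simp [ContinuousMap.sum_apply, coordSub, gC]
      rw [this]
      fun_prop
  have hLF : L J (∑ i, coordSub (z J) i * F i) =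
      ∑ k ∈ Finset.range (J + 1), c k * L J (∑ i, coordSub (z J) i * φ k i) := by
    simp only [F, Finset.mul_sum, map_sum]
    rw [Finset.sum_comm]
    refine Finset.sum_congr rfl fun k _ => Finset.sum_congr rfl fun i _ => ?_
    rw [mul_smul_comm, map_smul, smul_eq_mul]
  simp only [mul_sub, Finset.sum_sub_distrib, map_sub] at hG
  rw [hLg, hLF, zero_sub, norm_neg] at hG
  exact absurd (hc J) (not_lt.2 hG)

theorem polyHullCompact_polyHullCompact_subset {n : ℕ} {X : Set (Fin n → ℂ)} (hX : IsCompact X) :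
    polyHullCompact (polyHullCompact X) ⊆ polyHullCompact X := fun _ hz =>
  (mem_polyHullCompact_iff hX).2 fun p c hc h =>
    (mem_polyHullCompact_iff (isCompact_polyHullCompact hX)).1 hz p c hc fun _ hw =>
      (mem_polyHullCompact_iff hX).1 hw p c hc h

theorem mem_polyHull_iff {n : ℕ} {X : Set (Fin n → ℂ)} {z : Fin n → ℂ} :
    z ∈ polyHull X ↔ ∃ C, IsCompact C ∧ C ⊆ X ∧ z ∈ polyHullCompact C := by
  simp [polyHull, and_assoc]

/-- Every compact set can be enlarged to a compact set whose union with a given Carleman continuum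
is polynomially convex. -/
theorem IsCarleman.exists_compact_polyConvex {n : ℕ} {M : Set (Fin n → ℂ)} (hM : IsCarleman M)
    (hMc : IsClosed M) {K : Set (Fin n → ℂ)} (hK : IsCompact K) :
    ∃ K' : Set (Fin n → ℂ), IsCompact K' ∧ K ⊆ K' ∧ IsPolyConvex (K' ∪ M) := by
  obtain ⟨R, hR⟩ := hM.exists_radius hMc hK
  set X : ℕ → Set (Fin n → ℂ) := fun r => K ∪ (M ∩ Metric.closedBall 0 r) with hXdef
  have hXc : ∀ r, IsCompact (X r) := fun r =>
    hK.union ((isCompact_closedBall _ _).inter_left hMc)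
  have hXmono : Monotone X := fun r s hrs =>
    union_subset_union_right _ (inter_subset_inter_right _
      (Metric.closedBall_subset_closedBall (Nat.cast_le.2 hrs)))
  refine ⟨polyHullCompact (X R), isCompact_polyHullCompact (hXc R),
    subset_union_left.trans (subset_polyHullCompact (hXc R)), ?_⟩
  rw [IsPolyConvex, hHull, sdiff_eq_empty]
  intro z hz
  obtain ⟨C, hC, hCX, hzC⟩ := mem_polyHull_iff.1 hz
  obtain ⟨r, hr⟩ := hC.isBounded.exists_norm_le
  obtain ⟨S, hS⟩ := exists_nat_ge r
  have hCS : C ⊆ polyHullCompact (X (max S R)) := by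
    intro w hw
    rcases hCX hw with h | h
    · exact polyHullCompact_mono (hXc _) (hXc _) (hXmono (le_max_right _ _)) h
    · refine subset_polyHullCompact (hXc _) (Or.inr ⟨h, ?_⟩)
      rw [mem_closedBall_zero_iff]
      exact (hr w hw).trans (hS.trans (Nat.cast_le.2 (le_max_left _ _)))
  exact hR _ (polyHullCompact_polyHullCompact_subset (hXc _)
    (polyHullCompact_mono hC (isCompact_polyHullCompact (hXc _)) hCS hzC))

theorem IsCarleman.exists_peak {n : ℕ} {M : Set (Fin n → ℂ)} (hM : IsCarleman M)
    {z : Fin n → ℂ} (hz : z ∉ M) :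
    ∃ q : (Fin n → ℂ) → ℂ, Differentiable ℂ q ∧ q z = 1 ∧ ∀ w ∈ M, ‖q w‖ ≤ 1 / 2 := by
  have hpos : ∀ w ∈ M, 0 < ∑ i, ‖w i - z i‖ ^ 2 := fun w hw =>
    sum_norm_sub_sq_pos fun h => hz (by rwa [← h])
  let f : Fin n → (Fin n → ℂ) → ℂ := fun i w =>
    (starRingEnd ℂ) (w i - z i) * (((∑ i, ‖w i - z i‖ ^ 2)⁻¹ : ℝ) : ℂ)
  let ε : (Fin n → ℂ) → ℝ := fun w => (2 * (∑ i, ‖w i - z i‖ + 1))⁻¹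
  have hε1 : ∀ w : Fin n → ℂ, 0 < 2 * (∑ i, ‖w i - z i‖ + 1) := fun w => by positivity
  have hf : ∀ i, ContinuousOn (f i) M := fun i =>
    (Complex.continuous_conj.comp (by fun_prop)).continuousOn.mul
      (Complex.continuous_ofReal.comp_continuousOn
        (ContinuousOn.inv₀ (by fun_prop) fun w hw => (hpos w hw).ne'))
  have hε : ContinuousOn ε M :=
    (Continuous.inv₀ (by fun_prop) fun w => (hε1 w).ne').continuousOn
  choose g hg hgf using fun i => hM (f i) (hf i) ε hε fun w _ => inv_pos.2 (hε1 w)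
  refine ⟨fun w => 1 - ∑ i, (w i - z i) * g i w, by fun_prop, by simp, fun w hw => ?_⟩
  have h1 : (1 : ℂ) = ∑ i, (w i - z i) * f i w := by
    simp only [f, ← mul_assoc]
    rw [← Finset.sum_mul, sum_sub_mul_conj, ← Complex.ofReal_mul, mul_inv_cancel₀ (hpos w hw).ne',
      Complex.ofReal_one]
  have h2 : 1 - ∑ i, (w i - z i) * g i w = ∑ i, (w i - z i) * (f i w - g i w) := by
    simp only [mul_sub, Finset.sum_sub_distrib]
    rw [← h1]
  beta_reduce
  rw [h2]
  calc ‖∑ i, (w i - z i) * (f i w - g i w)‖ ≤ ∑ i, ‖w i - z i‖ * ε w := by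
        refine (norm_sum_le _ _).trans (Finset.sum_le_sum fun i _ => ?_)
        rw [norm_mul, norm_sub_rev (f i w)]
        exact mul_le_mul_of_nonneg_left (hgf i w hw).le (norm_nonneg _)
    _ = (∑ i, ‖w i - z i‖) * ε w := (Finset.sum_mul _ _ _).symm
    _ ≤ 1 / 2 := by
        rw [← div_eq_mul_inv, div_le_div_iff₀ (hε1 w) two_pos]
        linarith

/-- A function that is small near `K` and almost `1` on the part of `M` outside a fixed ball. -/
theorem ApproxProp.exists_radius_cutoff {n : ℕ} {M : Set (Fin n → ℂ)} (hM : ApproxProp M)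
    {K : Set (Fin n → ℂ)} (hK : IsCompact K) (hKM : IsPolyConvex (K ∪ M)) :
    ∃ R : ℝ, ∀ ε : ℝ, 0 < ε → ∃ g : (Fin n → ℂ) → ℂ, Differentiable ℂ g ∧
      (∀ w ∈ K, ‖g w‖ ≤ ε) ∧ (∀ w ∈ M, ‖g w‖ ≤ 1 + ε) ∧
      ∀ w ∈ M, R ≤ ‖w‖ → 1 - ε ≤ ‖g w‖ := by
  obtain ⟨R, hR⟩ := hK.isBounded.exists_pos_norm_lt
  refine ⟨R + 1, fun ε hε => ?_⟩
  let χ : (Fin n → ℂ) → ℝ := fun w => max 0 (min 1 (‖w‖ - R))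
  have hχ0 : ∀ w, ‖w‖ < R → χ w = 0 := fun w hw =>
    max_eq_left ((min_le_right _ _).trans (by linarith))
  have hχ1 : ∀ w, R + 1 ≤ ‖w‖ → χ w = 1 := fun w hw => by
    simp only [χ]
    rw [min_eq_left (by linarith), max_eq_right zero_le_one]
  have hχn : ∀ w, ‖(χ w : ℂ)‖ ≤ 1 := fun w => by
    rw [Complex.norm_real, Real.norm_of_nonneg (le_max_left _ _)]
    exact max_le zero_le_one (min_le_left _ _)
  have hχc : Continuous fun w => (χ w : ℂ) := Complex.continuous_ofReal.comp (by fun_prop)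
  obtain ⟨g, hg, hgχ⟩ := hM K hK hKM (fun w => (χ w : ℂ)) hχc.continuousOn
    ⟨Metric.ball 0 R, Metric.isOpen_ball, fun w hw => by simpa using hR.2 w hw,
      (differentiableOn_const (0 : ℂ)).congr fun w hw => by
        rw [hχ0 w (by simpa using hw), Complex.ofReal_zero]⟩
    (fun _ => ε) continuousOn_const fun _ _ => hε
  refine ⟨g, hg, fun w hw => ?_, fun w hw => ?_, fun w hw hwR => ?_⟩
  · have := hgχ w (Or.inl hw)
    rw [hχ0 w (hR.2 w hw), Complex.ofReal_zero, sub_zero] at this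
    exact this.le
  · have := hgχ w (Or.inr hw)
    have h2 := norm_le_norm_add_norm_sub' (g w) (χ w : ℂ)
    linarith [hχn w]
  · have := hgχ w (Or.inr hw)
    have h2 := norm_le_norm_add_norm_sub (g w) (χ w : ℂ)
    rw [hχ1 w hwR, Complex.ofReal_one, norm_one] at h2
    rw [hχ1 w hwR, Complex.ofReal_one] at this
    linarith

/-- Points of the hull of a subset of `K₁ × K₂ ∪ M₁ × M₂` lying in `M₁ᶜ × M₂` are bounded in the
second coordinate. -/
theorem exists_bound_snd_of_mem_hull {m n₁ n₂ : ℕ} {M₁ K₁ : Set (Fin n₁ → ℂ)}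
    {M₂ K₂ : Set (Fin n₂ → ℂ)} (hM₁ : IsCarleman M₁) (hM₂ : ApproxProp M₂)
    (hK₁ : IsCompact K₁) (hK₂ : IsCompact K₂) (hKM : IsPolyConvex (K₂ ∪ M₂))
    {π₁ : (Fin m → ℂ) → (Fin n₁ → ℂ)} {π₂ : (Fin m → ℂ) → (Fin n₂ → ℂ)}
    (hπ₁ : Differentiable ℂ π₁) (hπ₂ : Differentiable ℂ π₂) :
    ∃ R : ℝ, ∀ C : Set (Fin m → ℂ), IsCompact C →
      (∀ w ∈ C, (π₁ w ∈ K₁ ∧ π₂ w ∈ K₂) ∨ (π₁ w ∈ M₁ ∧ π₂ w ∈ M₂)) →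
      ∀ z ∈ polyHullCompact C, π₁ z ∉ M₁ → π₂ z ∈ M₂ → ‖π₂ z‖ ≤ R := by
  obtain ⟨R, hR⟩ := hM₂.exists_radius_cutoff hK₂ hKM
  refine ⟨R, fun C hC hCw z hz hz₁ hz₂ => ?_⟩
  by_contra! hlt
  obtain ⟨q, hq, hqz, hqM⟩ := hM₁.exists_peak hz₁
  obtain ⟨A, hA⟩ := hK₁.exists_bound_of_continuousOn hq.continuous.continuousOn
  have hA1 : 0 < |A| + 1 := by positivity
  obtain ⟨g, hg, hgK, hgM, hgR⟩ := hR (1 / (4 * (|A| + 1))) (by positivity)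
  have hε : 1 / (4 * (|A| + 1)) ≤ 1 / 4 := by
    apply one_div_le_one_div_of_le <;> linarith [abs_nonneg A]
  have hle := norm_le_of_mem_polyHullCompact hC hz ((hq.comp hπ₁).mul (hg.comp hπ₂))
    (c := 5 / 8) (by norm_num) fun w hw => ?_
  · have h1 := hgR _ hz₂ hlt.le
    simp only [Pi.mul_apply, Function.comp_apply, hqz, one_mul] at hle
    linarith
  · simp only [Pi.mul_apply, Function.comp_apply, norm_mul]
    rcases hCw w hw with ⟨h1, h2⟩ | ⟨h1, h2⟩
    · calc ‖q (π₁ w)‖ * ‖g (π₂ w)‖ ≤ (|A| + 1) * (1 / (4 * (|A| + 1))) :=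
            mul_le_mul ((hA _ h1).trans (by linarith [le_abs_self A])) (hgK _ h2)
              (norm_nonneg _) hA1.le
        _ ≤ 5 / 8 := by field_simp; norm_num
    · calc ‖q (π₁ w)‖ * ‖g (π₂ w)‖ ≤ 1 / 2 * (5 / 4) :=
            mul_le_mul (hqM _ h1) ((hgM _ h2).trans (by linarith)) (norm_nonneg _) (by norm_num)
        _ ≤ 5 / 8 := by norm_num

theorem map_mem_of_isPolyConvex {m n : ℕ} {C : Set (Fin m → ℂ)} (hC : IsCompact C)
    {z : Fin m → ℂ} (hz : z ∈ polyHullCompact C) {X : Set (Fin n → ℂ)} (hX : IsPolyConvex X)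
    {π : (Fin m → ℂ) → (Fin n → ℂ)} (hπ : Differentiable ℂ π) (h : ∀ w ∈ C, π w ∈ X) :
    π z ∈ X := by
  rw [IsPolyConvex, hHull, sdiff_eq_empty] at hX
  exact hX (mem_polyHull_iff.2 ⟨π '' C, hC.image hπ.continuous, image_subset_iff.2 h,
    map_mem_polyHullCompact hC hz hπ⟩)

/-- the product of two Carleman continua with the approximation property
has bounded E-hulls. -/
theorem prod_hasBoundedEHulls {n₁ n₂ : ℕ}
    (M₁ : Set (Fin n₁ → ℂ)) (M₂ : Set (Fin n₂ → ℂ))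
    (hM₁closed : IsClosed M₁) (hM₂closed : IsClosed M₂)
    (hM₁car : IsCarleman M₁) (hM₂car : IsCarleman M₂)
    (hM₁ap : ApproxProp M₁) (hM₂ap : ApproxProp M₂) :
    HasBoundedEHulls (prodSet M₁ M₂) := by
  intro K hK
  set π₁ : (Fin (n₁ + n₂) → ℂ) → (Fin n₁ → ℂ) := fun z i => z (Fin.castAdd n₂ i) with hπ₁def
  set π₂ : (Fin (n₁ + n₂) → ℂ) → (Fin n₂ → ℂ) := fun z i => z (Fin.natAdd n₁ i) with hπ₂def
  have hπ₁ : Differentiable ℂ π₁ := by fun_prop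
  have hπ₂ : Differentiable ℂ π₂ := by fun_prop
  obtain ⟨K₁, hK₁, hKK₁, hc₁⟩ := hM₁car.exists_compact_polyConvex hM₁closed
    (hK.image hπ₁.continuous)
  obtain ⟨K₂, hK₂, hKK₂, hc₂⟩ := hM₂car.exists_compact_polyConvex hM₂closed
    (hK.image hπ₂.continuous)
  obtain ⟨R₂, hR₂⟩ := exists_bound_snd_of_mem_hull hM₁car hM₂ap hK₁ hK₂ hc₂ hπ₁ hπ₂
  obtain ⟨R₁, hR₁⟩ := exists_bound_snd_of_mem_hull hM₂car hM₁ap hK₂ hK₁ hc₁ hπ₂ hπ₁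
  obtain ⟨r₁, hr₁⟩ := hK₁.isBounded.exists_norm_le
  obtain ⟨r₂, hr₂⟩ := hK₂.isBounded.exists_norm_le
  refine isBounded_iff_forall_norm_le.2 ⟨max (max r₁ R₁) (max r₂ R₂), ?_⟩
  rintro z ⟨hz, hzKM⟩
  obtain ⟨C, hC, hCK, hzC⟩ := mem_polyHull_iff.1 hz
  have hCw : ∀ w ∈ C, (π₁ w ∈ K₁ ∧ π₂ w ∈ K₂) ∨ (π₁ w ∈ M₁ ∧ π₂ w ∈ M₂) := fun w hw =>
    (hCK hw).imp (fun h => ⟨hKK₁ (mem_image_of_mem _ h), hKK₂ (mem_image_of_mem _ h)⟩) fun h => h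
  have hz₁ : π₁ z ∈ K₁ ∪ M₁ := map_mem_of_isPolyConvex hC hzC hc₁ hπ₁ fun w hw =>
    (hCw w hw).imp (fun h => h.1) fun h => h.1
  have hz₂ : π₂ z ∈ K₂ ∪ M₂ := map_mem_of_isPolyConvex hC hzC hc₂ hπ₂ fun w hw =>
    (hCw w hw).imp (fun h => h.2) fun h => h.2
  have hnot : ¬(π₁ z ∈ M₁ ∧ π₂ z ∈ M₂) := fun h => hzKM (Or.inr h)
  have hb₁ : ‖π₁ z‖ ≤ max r₁ R₁ := by
    by_cases h : π₁ z ∈ K₁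
    · exact (hr₁ _ h).trans (le_max_left _ _)
    · have h1 := hz₁.resolve_left h
      exact (hR₁ C hC (fun w hw => (hCw w hw).imp And.symm And.symm) z hzC
        (fun h2 => hnot ⟨h1, h2⟩) h1).trans (le_max_right _ _)
  have hb₂ : ‖π₂ z‖ ≤ max r₂ R₂ := by
    by_cases h : π₂ z ∈ K₂
    · exact (hr₂ _ h).trans (le_max_left _ _)
    · have h2 := hz₂.resolve_left h
      exact (hR₂ C hC hCw z hzC (fun h1 => hnot ⟨h1, h2⟩) h2).trans (le_max_right _ _)
  have h0 : 0 ≤ max (max r₁ R₁) (max r₂ R₂) :=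
    (norm_nonneg (π₁ z)).trans (hb₁.trans (le_max_left _ _))
  rw [pi_norm_le_iff_of_nonneg h0]
  intro k
  refine Fin.addCases (fun i => ?_) (fun i => ?_) k
  · exact (norm_le_pi_norm (π₁ z) i).trans (hb₁.trans (le_max_left _ _))
  · exact (norm_le_pi_norm (π₂ z) i).trans (hb₂.trans (le_max_right _ _))
end
end

section
/- Let M ⊆ ℂⁿ be a closed set with bounded E-hulls. Then there exists a normal exhaustion of ℂⁿ by compact sets K₁ ⊆ K₂ ⊆ K₃ ⊆ ⋯ (i.e., K_j is contained in the interior of K_{j+1} for every j and the union of the K_j equals ℂⁿ) such that K_j ∪ M is polynomially convex for every j. -/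
open Set

noncomputable section

section PowersInAlgebras

open Filter Topology UniformSpace
open scoped Pointwise

/-- If every contractive character of a complex seminormed algebra maps `p` into the open unit
disc, then the powers of `p` tend to zero. -/
theorem tendsto_norm_pow_zero_of_characters {L : Type*} [SeminormedCommRing L] [NormedAlgebra ℂ L]
    (h1 : ‖(1 : L)‖ ≤ 1) (p : L)
    (hp : ∀ χ : L →ₐ[ℂ] ℂ, (∀ x, ‖χ x‖ ≤ ‖x‖) → ‖χ p‖ < 1) :
    Tendsto (fun N : ℕ => ‖p ^ N‖) atTop (𝓝 0) := by
  have hcoe : ∀ N : ℕ, ‖p ^ N‖ = ‖(p : Completion L) ^ N‖ := fun N => by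
    rw [← Completion.norm_coe]
    exact congrArg norm (map_pow (Completion.coeRingHom (α := L)) p N)
  simp_rw [hcoe]
  rcases subsingleton_or_nontrivial (Completion L) with hs | hs
  · simp [Subsingleton.elim _ (0 : Completion L)]
  have hspec : ∀ z ∈ spectrum ℂ (p : Completion L), ‖z‖₊ < 1 := by
    intro z hz
    obtain ⟨f, rfl⟩ := WeakDual.CharacterSpace.mem_spectrum_iff_exists.1 hz
    have hf : ∀ x : L, ‖f (x : Completion L)‖ ≤ ‖x‖ := fun x => by
      have h := AlgHom.norm_apply_le_self_mul_norm_one f (x : Completion L)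
      rw [← Completion.coe_one, Completion.norm_coe, Completion.norm_coe] at h
      exact h.trans (mul_le_of_le_one_right (norm_nonneg _) h1)
    let g : Completion L →ₐ[ℂ] ℂ := WeakDual.CharacterSpace.toAlgHom f
    let χ : L →ₐ[ℂ] ℂ :=
      { g.toRingHom.comp Completion.coeRingHom with
        commutes' := fun r => by
          have := g.commutes r
          rw [Completion.algebraMap_def] at this
          exact this }
    exact hp χ hf
  have hr := spectrum.spectralRadius_lt_of_forall_lt (p : Completion L) hspec
  obtain ⟨s, hs1, hs2⟩ := ENNReal.lt_iff_exists_nnreal_btwn.1 hr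
  have hev := (spectrum.pow_nnnorm_pow_one_div_tendsto_nhds_spectralRadius
    (p : Completion L)).eventually (gt_mem_nhds hs1)
  have hs2' : s < 1 := by exact_mod_cast hs2
  refine squeeze_zero' (Eventually.of_forall fun _ => norm_nonneg _) ?_
    (tendsto_pow_atTop_nhds_zero_of_lt_one s.2 (NNReal.coe_lt_one.2 hs2'))
  filter_upwards [hev, eventually_gt_atTop 0] with N hN hN0
  have hN0' : (0 : ℝ) < N := by exact_mod_cast hN0
  rw [one_div, ENNReal.rpow_inv_lt_iff hN0', ENNReal.rpow_natCast] at hN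
  exact_mod_cast hN.le

/-- The unbundled form of `tendsto_norm_pow_zero_of_characters`. -/
theorem RingSeminorm.tendsto_pow_zero_of_characters {L : Type*} [CommRing L] [Algebra ℂ L]
    (A : RingSeminorm L) (hsmul : ∀ (r : ℂ) x, A (r • x) ≤ ‖r‖ * A x) (h1 : A 1 ≤ 1) (p : L)
    (hp : ∀ χ : L →ₐ[ℂ] ℂ, (∀ x, ‖χ x‖ ≤ A x) → ‖χ p‖ < 1) :
    Tendsto (fun N : ℕ => A (p ^ N)) atTop (𝓝 0) := by
  let _ : SeminormedCommRing L := { A.toSeminormedRing, ‹CommRing L› with }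
  let _ : NormedAlgebra ℂ L := { ‹Algebra ℂ L› with norm_smul_le := hsmul }
  exact tendsto_norm_pow_zero_of_characters (L := L) h1 p hp

/-- The version of `tendsto_norm_pow_zero_of_characters` for the gauge of a multiplicative,
absolutely convex, absorbing set `S`. -/
theorem eventually_pow_mem_smul_of_characters {L : Type*} [CommRing L] [Algebra ℂ L] {S : Set L}
    (hbal : Balanced ℂ S) (hconv : Convex ℝ S) (habs : Absorbent ℝ S) (h1 : 1 ∈ S)
    (hmul : ∀ x ∈ S, ∀ y ∈ S, x * y ∈ S) (p : L)
    (hp : ∀ χ : L →ₐ[ℂ] ℂ, (∀ x ∈ S, ‖χ x‖ ≤ 1) → ‖χ p‖ < 1) {η : ℝ} (hη : 0 < η) :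
    ∀ᶠ N : ℕ in atTop, ∃ s ∈ S, p ^ N = η • s := by
  let ν := gaugeSeminorm (𝕜 := ℂ) hbal hconv habs
  have hνmul : ∀ x y, ν (x * y) ≤ ν x * ν y := by
    intro x y
    refine le_of_forall_gt_imp_ge_of_dense fun t ht => ?_
    obtain ⟨a, ha, b, hb, hab⟩ : ∃ a, ν x < a ∧ ∃ b, ν y < b ∧ a * b < t := by
      have hc : Tendsto (fun e : ℝ => (ν x + e) * (ν y + e)) (𝓝[>] 0)
          (𝓝 ((ν x + 0) * (ν y + 0))) :=
        (Continuous.tendsto (by fun_prop) 0).mono_left nhdsWithin_le_nhds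
      rw [add_zero, add_zero] at hc
      obtain ⟨e, he, he0⟩ := ((hc.eventually (gt_mem_nhds ht)).and self_mem_nhdsWithin).exists
      exact ⟨_, lt_add_of_pos_right _ he0, _, lt_add_of_pos_right _ he0, he⟩
    obtain ⟨a', ha0, ha', s, hs, rfl⟩ := exists_lt_of_gauge_lt habs ha
    obtain ⟨b', hb0, hb', u, hu, rfl⟩ := exists_lt_of_gauge_lt habs hb
    refine le_trans ?_ (le_trans (mul_le_mul ha'.le hb'.le hb0.le (ha0.le.trans ha'.le)) hab.le)
    exact gauge_le_of_mem (mul_nonneg ha0.le hb0.le)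
      ⟨s * u, hmul _ hs _ hu, (smul_mul_smul_comm _ _ _ _).symm⟩
  let A : RingSeminorm L := { ν.toAddGroupSeminorm with mul_le' := hνmul }
  have key := A.tendsto_pow_zero_of_characters (fun r x => (map_smul_eq_mul ν r x).le)
    (gauge_le_one_of_mem h1) p
    fun χ hχ => hp χ fun x hx => (hχ x).trans (gauge_le_one_of_mem hx)
  filter_upwards [key.eventually (gt_mem_nhds hη)] with N hN
  obtain ⟨r, hr0, hr, s, hs, hsN⟩ := exists_lt_of_gauge_lt habs hN
  refine ⟨((r / η : ℝ) : ℂ) • s, hbal.smul_mem ?_ hs, ?_⟩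
  · rw [Complex.norm_real, Real.norm_of_nonneg (by positivity), div_le_one hη]
    exact hr.le
  · rw [← hsN, Complex.coe_smul, smul_smul, mul_div_cancel₀ _ hη.ne']

open MvPolynomial in
/-- Auxiliary form of `eventually_exists_poly_approx_pow`, for an arbitrary model of the
localization at `φ`. -/
theorem eventually_exists_poly_approx_pow_of_isLocalization {σ L : Type*} {E : Set (σ → ℂ)}
    (φ p : MvPolynomial σ ℂ) [CommRing L] [Algebra ℂ L] [Algebra (MvPolynomial σ ℂ) L]
    [IsScalarTower ℂ (MvPolynomial σ ℂ) L] [IsLocalization.Away φ L]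
    (hbdd : ∀ q : MvPolynomial σ ℂ, ∃ B : ℝ, ∀ z ∈ E, ‖eval z q‖ ≤ B)
    (hconv : ∀ z, (∀ q : MvPolynomial σ ℂ, (∀ w ∈ E, ‖eval w q‖ ≤ 1) → ‖eval z q‖ ≤ 1) → z ∈ E)
    (hp : ∀ z ∈ E, ‖eval z φ‖ = 1 → ‖eval z p‖ < 1) {η : ℝ} (hη : 0 < η) :
    ∀ᶠ N : ℕ in atTop, ∃ Φ : MvPolynomial σ ℂ,
      (∀ z ∈ E, ‖eval z φ‖ ≤ 1 → ‖eval z p ^ N - eval z Φ‖ ≤ η) ∧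
      (∀ z ∈ E, 1 ≤ ‖eval z φ‖ → ‖eval z Φ‖ ≤ η) := by
  let ι : MvPolynomial σ ℂ →ₐ[ℂ] L := IsScalarTower.toAlgHom ℂ _ _
  have hu : IsUnit (ι φ) := IsLocalization.Away.algebraMap_isUnit φ
  obtain ⟨u, hu⟩ := hu
  let J : Set (MvPolynomial σ ℂ) := {q | ∀ z ∈ E, ‖eval z q‖ ≤ 1}
  have hJ1 : (1 : MvPolynomial σ ℂ) ∈ J := fun z _ => by simp
  let M : Set L := {x | ∃ q ∈ J, ∃ k : ℤ, x = ι q * (u ^ k : Lˣ)}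
  have hMS : M ⊆ convexHull ℝ M := subset_convexHull ℝ M
  have hMbal : ∀ a : ℂ, ‖a‖ ≤ 1 → ∀ x ∈ M, a • x ∈ M := by
    rintro a ha _ ⟨q, hq, k, rfl⟩
    refine ⟨a • q, fun z hz => ?_, k, by rw [map_smul, smul_mul_assoc]⟩
    rw [smul_eval, norm_mul]
    exact mul_le_one₀ ha (norm_nonneg _) (hq z hz)
  have hMmul : ∀ x ∈ M, ∀ y ∈ M, x * y ∈ M := by
    rintro _ ⟨q, hq, k, rfl⟩ _ ⟨r, hr, l, rfl⟩
    refine ⟨q * r, fun z hz => ?_, k + l, ?_⟩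
    · rw [map_mul, norm_mul]
      exact mul_le_one₀ (hq z hz) (norm_nonneg _) (hr z hz)
    · rw [map_mul, zpow_add, Units.val_mul]
      ring
  have hιM : ∀ q ∈ J, ι q ∈ M := fun q hq => ⟨q, hq, 0, by simp⟩
  have huM : ∀ k : ℤ, ((u ^ k : Lˣ) : L) ∈ M := fun k => ⟨1, hJ1, k, by simp⟩
  have hSbal : Balanced ℂ (convexHull ℝ M) := by
    refine balanced_iff_smul_mem.2 fun a ha => ?_
    have hc := (convex_convexHull ℝ M).linear_preimage
      ((LinearMap.lsmul ℂ L a).restrictScalars ℝ)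
    exact convexHull_min (fun x hx => hMS (hMbal a ha x hx)) hc
  have hSmul : ∀ x ∈ convexHull ℝ M, ∀ y ∈ convexHull ℝ M, x * y ∈ convexHull ℝ M := by
    have step : ∀ y ∈ M, ∀ x ∈ convexHull ℝ M, x * y ∈ convexHull ℝ M := fun y hy =>
      convexHull_min (fun x hx => hMS (hMmul x hx y hy))
        ((convex_convexHull ℝ M).linear_preimage ((LinearMap.mulRight ℂ y).restrictScalars ℝ))
    exact fun x hx => convexHull_min (fun y hy => step y hy x hx)
      ((convex_convexHull ℝ M).linear_preimage ((LinearMap.mulLeft ℂ x).restrictScalars ℝ))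
  have hSabs : Absorbent ℝ (convexHull ℝ M) := by
    refine absorbent_iff_inv_smul.2 fun l => ?_
    obtain ⟨k, f, hf⟩ := IsLocalization.Away.surj φ l
    obtain ⟨B, hB⟩ := hbdd f
    have hl : l = ι f * (u ^ (-(k : ℤ)) : Lˣ) := by
      have hf' : l * (u ^ k : Lˣ) = ι f := by
        rw [Units.val_pow_eq_pow_val, hu]
        exact hf
      rw [← hf', mul_assoc, ← Units.val_mul, zpow_neg, zpow_natCast, mul_inv_cancel,
        Units.val_one, mul_one]
    filter_upwards [eventually_cobounded_le_norm (max B 1)] with c hc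
    have hc0 : 0 < ‖c‖ := one_pos.trans_le ((le_max_right _ _).trans hc)
    refine hMS ⟨((c⁻¹ : ℝ) : ℂ) • f, fun z hz => ?_, -(k : ℤ), ?_⟩
    · rw [smul_eval, norm_mul, Complex.norm_real, norm_inv, inv_mul_le_iff₀ hc0, mul_one]
      exact (hB z hz).trans ((le_max_left _ _).trans hc)
    · rw [map_smul, smul_mul_assoc, ← hl]
      rfl
  have hchar : ∀ χ : L →ₐ[ℂ] ℂ, (∀ x ∈ convexHull ℝ M, ‖χ x‖ ≤ 1) → ‖χ (ι p)‖ < 1 := by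
    intro χ hχ
    let z : σ → ℂ := fun i => χ (ι (X i))
    have hz : ∀ q, χ (ι q) = eval z q := fun q => by
      have : χ.comp ι = aeval z := MvPolynomial.algHom_ext fun i => by simp [z]
      exact DFunLike.congr_fun this q
    have hzE : z ∈ E := hconv z fun q hq => by
      rw [← hz]
      exact hχ _ (hMS (hιM q hq))
    rw [hz]
    refine hp z hzE ?_
    have h1 := hχ _ (hMS (huM 1))
    have h2 := hχ _ (hMS (huM (-1)))
    have h3 : ‖χ ((u ^ (1 : ℤ) : Lˣ) : L)‖ * ‖χ ((u ^ (-1 : ℤ) : Lˣ) : L)‖ = 1 := by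
      rw [← norm_mul, ← map_mul, ← Units.val_mul]
      simp
    rw [← hz, ← hu, ← zpow_one u]
    refine le_antisymm h1 ?_
    rw [← h3]
    exact mul_le_of_le_one_right (norm_nonneg _) h2
  let D : Set L := {h | ∃ Ψ : MvPolynomial σ ℂ, (∀ z ∈ E, ‖eval z φ‖ ≤ 1 → ‖eval z Ψ‖ ≤ 1) ∧
    ∀ (χ : L →ₐ[ℂ] ℂ), ∀ z ∈ E, (∀ q, χ (ι q) = eval z q) → 1 ≤ ‖eval z φ‖ →
      ‖χ h - eval z Ψ‖ ≤ 1}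
  have hSD : convexHull ℝ M ⊆ D := by
    refine convexHull_min ?_ ?_
    · rintro _ ⟨q, hq, k, rfl⟩
      obtain ⟨k, rfl | rfl⟩ := k.eq_nat_or_neg
      · refine ⟨q * φ ^ k, fun z hz hφ => ?_, fun χ z hz hχ hφ => ?_⟩
        · rw [map_mul, map_pow, norm_mul, norm_pow]
          exact mul_le_one₀ (hq z hz) (by positivity) (pow_le_one₀ (norm_nonneg _) hφ)
        · rw [zpow_natCast, Units.val_pow_eq_pow_val, hu, ← map_pow, ← map_mul, hχ]
          simp
      · refine ⟨0, fun z hz hφ => by simp, fun χ z hz hχ hφ => ?_⟩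
        have h3 : χ ((u⁻¹ : Lˣ) : L) = (eval z φ)⁻¹ := by
          refine eq_inv_of_mul_eq_one_left ?_
          rw [← hχ, ← hu, ← map_mul, ← Units.val_mul]
          simp
        rw [map_zero, sub_zero, map_mul, hχ, zpow_neg, zpow_natCast, ← inv_pow,
          Units.val_pow_eq_pow_val, map_pow, h3, norm_mul, norm_pow, norm_inv]
        exact mul_le_one₀ (hq z hz) (by positivity)
          (pow_le_one₀ (by positivity) (inv_le_one_of_one_le₀ hφ))
    · rintro h ⟨Ψ, hΨ, hΨ'⟩ h' ⟨Ψ', hΨ₁, hΨ₁'⟩ a b ha hb hab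
      have hcomb : ∀ s t : ℂ, ‖s‖ ≤ 1 → ‖t‖ ≤ 1 → ‖(a : ℂ) * s + b * t‖ ≤ 1 := by
        intro s t hs ht
        have hs' : s ∈ Metric.closedBall (0 : ℂ) 1 := by simpa using hs
        have ht' : t ∈ Metric.closedBall (0 : ℂ) 1 := by simpa using ht
        simpa using convex_closedBall (0 : ℂ) 1 hs' ht' ha hb hab
      refine ⟨C (a : ℂ) * Ψ + C (b : ℂ) * Ψ', fun z hz hφ => ?_, fun χ z hz hχ hφ => ?_⟩
      · simpa using hcomb _ _ (hΨ z hz hφ) (hΨ₁ z hz hφ)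
      · convert hcomb _ _ (hΨ' χ z hz hχ hφ) (hΨ₁' χ z hz hχ hφ) using 2
        have hr : ∀ (r : ℝ) (l : L), χ (r • l) = (r : ℂ) * χ l := fun r l =>
          map_smul χ (r : ℂ) l
        simp only [map_add, map_mul, eval_C, hr]
        ring
  filter_upwards [eventually_pow_mem_smul_of_characters hSbal (convex_convexHull ℝ M) hSabs
    (hMS (by simpa using huM 0)) hSmul (ι p) hchar hη] with N hN
  obtain ⟨s, hs, hsN⟩ := hN
  obtain ⟨Ψ, hΨ, hΨ'⟩ := hSD hs
  have hηnorm : ∀ s : ℂ, ‖s‖ ≤ 1 → ‖(η : ℂ) * s‖ ≤ η := fun s hs => by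
    rw [norm_mul, Complex.norm_real, Real.norm_of_nonneg hη.le]
    exact mul_le_of_le_one_right hη.le hs
  refine ⟨p ^ N - C (η : ℂ) * Ψ, fun z hz hφ => ?_, fun z hz hφ => ?_⟩
  · simpa using hηnorm _ (hΨ z hz hφ)
  · have hne : eval z φ ≠ 0 := norm_pos_iff.1 (one_pos.trans_le hφ)
    let χ : L →ₐ[ℂ] ℂ := IsLocalization.Away.liftAlgHom φ (f := aeval z)
      (by simpa [aeval_eq_eval] using hne)
    have hχ : ∀ q, χ (ι q) = eval z q := fun q => by
      simp [χ, ι]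
    convert hηnorm _ (hΨ' χ z hz hχ hφ) using 2
    have hpN : eval z p ^ N = η * χ s := by
      rw [← hχ, ← map_pow, hsN]
      exact map_smul χ (η : ℂ) s
    simp only [map_sub, map_mul, map_pow, eval_C, hpN]
    ring

open MvPolynomial in
/-- Let `E` be a polynomially convex set on which polynomials are bounded. If `|p| < 1` on
`E ∩ {|φ| = 1}`, then some polynomial is uniformly close to a large power of `p` on
`E ∩ {|φ| ≤ 1}` and uniformly small on `E ∩ {1 ≤ |φ|}`. -/
theorem eventually_exists_poly_approx_pow {σ : Type*} {E : Set (σ → ℂ)} (φ p : MvPolynomial σ ℂ)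
    (hbdd : ∀ q : MvPolynomial σ ℂ, ∃ B : ℝ, ∀ z ∈ E, ‖eval z q‖ ≤ B)
    (hconv : ∀ z, (∀ q : MvPolynomial σ ℂ, (∀ w ∈ E, ‖eval w q‖ ≤ 1) → ‖eval z q‖ ≤ 1) → z ∈ E)
    (hp : ∀ z ∈ E, ‖eval z φ‖ = 1 → ‖eval z p‖ < 1) {η : ℝ} (hη : 0 < η) :
    ∀ᶠ N : ℕ in atTop, ∃ Φ : MvPolynomial σ ℂ,
      (∀ z ∈ E, ‖eval z φ‖ ≤ 1 → ‖eval z p ^ N - eval z Φ‖ ≤ η) ∧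
      (∀ z ∈ E, 1 ≤ ‖eval z φ‖ → ‖eval z Φ‖ ≤ η) :=
  eventually_exists_poly_approx_pow_of_isLocalization (L := Localization.Away φ) φ p
    hbdd hconv hp hη

end PowersInAlgebras

section Hull

open Filter Topology

variable {n : ℕ} {C C' X : Set (Fin n → ℂ)} {z : Fin n → ℂ}

theorem norm_eval_le_of_mem_polyHullCompact (hz : z ∈ polyHullCompact C)
    {p : MvPolynomial (Fin n) ℂ} {B : ℝ} (hB : 0 ≤ B)
    (h : ∀ w ∈ C, ‖MvPolynomial.eval w p‖ ≤ B) : ‖MvPolynomial.eval z p‖ ≤ B :=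
  (hz p).trans (Real.sSup_le (forall_mem_image.2 h) hB)

theorem IsCompact.bddAbove_norm_eval (hC : IsCompact C) (p : MvPolynomial (Fin n) ℂ) :
    BddAbove ((fun w => ‖MvPolynomial.eval w p‖) '' C) :=
  hC.bddAbove_image (MvPolynomial.continuous_eval p).norm.continuousOn

theorem mem_polyHullCompact_of_forall (hC : IsCompact C)
    (h : ∀ (p : MvPolynomial (Fin n) ℂ) (B : ℝ), 0 ≤ B →
      (∀ w ∈ C, ‖MvPolynomial.eval w p‖ ≤ B) → ‖MvPolynomial.eval z p‖ ≤ B) :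
    z ∈ polyHullCompact C := fun p =>
  h p _ (Real.sSup_nonneg (forall_mem_image.2 fun _ _ => norm_nonneg _)) fun _ hw =>
    le_csSup (hC.bddAbove_norm_eval p) (mem_image_of_mem _ hw)

theorem subset_polyHullCompact_s9 (hC : IsCompact C) : C ⊆ polyHullCompact C := fun _ hz =>
  mem_polyHullCompact_of_forall hC fun _ _ _ h => h _ hz

theorem polyHullCompact_subset_of_subset (hC' : IsCompact C') (h : C ⊆ polyHullCompact C') :
    polyHullCompact C ⊆ polyHullCompact C' := fun _ hz =>
  mem_polyHullCompact_of_forall hC' fun _ _ hB hp =>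
    norm_eval_le_of_mem_polyHullCompact hz hB fun _ hw =>
      norm_eval_le_of_mem_polyHullCompact (h hw) hB hp

theorem polyHullCompact_mono_s9 (hC' : IsCompact C') (h : C ⊆ C') :
    polyHullCompact C ⊆ polyHullCompact C' :=
  polyHullCompact_subset_of_subset hC' (h.trans (subset_polyHullCompact_s9 hC'))

theorem norm_apply_le_of_mem_polyHullCompact (hz : z ∈ polyHullCompact C) {i : Fin n} {R : ℝ}
    (hR : 0 ≤ R) (h : ∀ w ∈ C, ‖w i‖ ≤ R) : ‖z i‖ ≤ R := by
  simpa using norm_eval_le_of_mem_polyHullCompact hz (p := MvPolynomial.X i) hR (by simpa using h)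

theorem norm_le_of_mem_polyHullCompact_s9 (hz : z ∈ polyHullCompact C) {R : ℝ} (hR : 0 ≤ R)
    (h : ∀ w ∈ C, ‖w‖ ≤ R) : ‖z‖ ≤ R :=
  (pi_norm_le_iff_of_nonneg hR).2 fun i => norm_apply_le_of_mem_polyHullCompact hz hR
    fun w hw => (norm_le_pi_norm w i).trans (h w hw)

theorem isCompact_polyHullCompact_s9 (hC : IsCompact C) : IsCompact (polyHullCompact C) := by
  have hclosed : IsClosed (polyHullCompact C) := by
    simp only [polyHullCompact, ofPred_forall]
    exact isClosed_iInter fun p =>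
      isClosed_le (MvPolynomial.continuous_eval p).norm continuous_const
  obtain ⟨R, hR, hCR⟩ := hC.isBounded.exists_pos_norm_le
  refine (isCompact_closedBall (0 : Fin n → ℂ) R).of_isClosed_subset hclosed fun z hz => ?_
  simpa using norm_le_of_mem_polyHullCompact_s9 hz hR.le hCR

/-- A form of Rossi's local maximum principle: if the hull of `C` coincides with `C` on
`{|φ| = 1}`, then the part of the hull in `{|φ| ≤ 1}` only depends on `C ∩ {|φ| ≤ 1}`. -/
theorem mem_polyHullCompact_inter_sublevel (hC : IsCompact C) (φ : MvPolynomial (Fin n) ℂ)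
    (hφ : ∀ w ∈ polyHullCompact C, ‖MvPolynomial.eval w φ‖ = 1 → w ∈ C)
    (hz : z ∈ polyHullCompact C) (hzφ : ‖MvPolynomial.eval z φ‖ ≤ 1) :
    z ∈ polyHullCompact (C ∩ {w | ‖MvPolynomial.eval w φ‖ ≤ 1}) := by
  have hC₁ : IsCompact (C ∩ {w | ‖MvPolynomial.eval w φ‖ ≤ 1}) :=
    hC.inter_right (isClosed_le (MvPolynomial.continuous_eval φ).norm continuous_const)
  refine mem_polyHullCompact_of_forall hC₁ fun p B hB hpB => le_of_not_gt fun hlt => ?_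
  have hpz : 0 < ‖MvPolynomial.eval z p‖ := hB.trans_lt hlt
  set t := B / ‖MvPolynomial.eval z p‖ with ht
  have ht0 : 0 ≤ t := by positivity
  have ht1 : t < 1 := (div_lt_one hpz).2 hlt
  let p' := MvPolynomial.C (MvPolynomial.eval z p)⁻¹ * p
  have hp'z : MvPolynomial.eval z p' = 1 := by
    simp [p', inv_mul_cancel₀ (norm_pos_iff.1 hpz)]
  have hp' : ∀ w ∈ C, ‖MvPolynomial.eval w φ‖ ≤ 1 → ‖MvPolynomial.eval w p'‖ ≤ t := by
    intro w hw hwφ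
    simp only [p', map_mul, MvPolynomial.eval_C, norm_mul, norm_inv, ht, div_eq_inv_mul]
    exact mul_le_mul_of_nonneg_left (hpB w ⟨hw, hwφ⟩) (by positivity)
  have hev := eventually_exists_poly_approx_pow (E := polyHullCompact C) φ p'
    (fun q => by
      obtain ⟨B, hB⟩ := (isCompact_polyHullCompact_s9 hC).bddAbove_norm_eval q
      exact ⟨B, fun w hw => hB (mem_image_of_mem _ hw)⟩)
    (fun w hw => by
      refine mem_polyHullCompact_of_forall hC fun q B hB hq => ?_
      refine le_of_forall_gt_imp_ge_of_dense fun b hb => ?_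
      have hb0 : 0 < b := hB.trans_lt hb
      have := hw (MvPolynomial.C (b⁻¹ : ℂ) * q) fun v hv => by
        have hvq := (norm_eval_le_of_mem_polyHullCompact hv hB hq).trans hb.le
        simp only [map_mul, MvPolynomial.eval_C, norm_mul, norm_inv, Complex.norm_real,
          Real.norm_of_nonneg hb0.le]
        rwa [inv_mul_le_iff₀ hb0, mul_one]
      simp only [map_mul, MvPolynomial.eval_C, norm_mul, norm_inv, Complex.norm_real,
        Real.norm_of_nonneg hb0.le] at this
      rwa [inv_mul_le_iff₀ hb0, mul_one] at this)
    (fun w hw hwφ => (hp' w (hφ w hw hwφ) hwφ.le).trans_lt ht1)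
    (η := 1 / 4) (by norm_num)
  obtain ⟨N, ⟨Φ, hΦ₁, hΦ₂⟩, hN⟩ := (hev.and ((tendsto_pow_atTop_nhds_zero_of_lt_one ht0
    ht1).eventually (gt_mem_nhds (show (0 : ℝ) < 1 / 4 by norm_num)))).exists
  have h1 := hΦ₁ z hz hzφ
  have h2 : ‖MvPolynomial.eval z Φ‖ ≤ 1 / 2 := by
    refine norm_eval_le_of_mem_polyHullCompact hz (by norm_num) fun w hw => ?_
    rcases le_total ‖MvPolynomial.eval w φ‖ 1 with h | h
    · have h3 := hΦ₁ w (subset_polyHullCompact_s9 hC hw) h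
      have h4 : ‖MvPolynomial.eval w p' ^ N‖ ≤ t ^ N := by
        rw [norm_pow]
        exact pow_le_pow_left₀ (norm_nonneg _) (hp' w hw h) N
      have h5 := norm_sub_norm_le (MvPolynomial.eval w Φ) (MvPolynomial.eval w p' ^ N)
      rw [norm_sub_rev] at h5
      linarith
    · exact (hΦ₂ w (subset_polyHullCompact_s9 hC hw) h).trans (by norm_num)
  rw [hp'z, one_pow] at h1
  have h3 := norm_sub_norm_le 1 (MvPolynomial.eval z Φ)
  rw [norm_one] at h3
  linarith

/-- If the hull of `C` coincides with `C` outside the open polydisc of radius `c`, then the part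
of the hull in the closed polydisc only depends on the part of `C` in the closed polydisc. -/
theorem mem_polyHullCompact_inter_closedBall (hC : IsCompact C) {c : ℝ} (hc : 0 < c)
    (h : ∀ w ∈ polyHullCompact C, c ≤ ‖w‖ → w ∈ C) (hz : z ∈ polyHullCompact C)
    (hzc : ‖z‖ ≤ c) : z ∈ polyHullCompact (C ∩ Metric.closedBall 0 c) := by
  have key : ∀ s : Finset (Fin n), z ∈ polyHullCompact (C ∩ {w | ∀ i ∈ s, ‖w i‖ ≤ c}) := by
    intro s
    induction s using Finset.induction_on with
    | empty => simpa using hz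
    | insert i s _ ih =>
      have hCs : IsCompact (C ∩ {w | ∀ i ∈ s, ‖w i‖ ≤ c}) := by
        refine hC.inter_right ?_
        simp only [ofPred_forall]
        exact isClosed_biInter fun j _ =>
          isClosed_le (continuous_apply j).norm continuous_const
      have hφ : ∀ w : Fin n → ℂ, ‖MvPolynomial.eval w
          (MvPolynomial.C (c⁻¹ : ℂ) * MvPolynomial.X i)‖ = c⁻¹ * ‖w i‖ := fun w => by
        simp [abs_of_pos hc]
      have hstep := mem_polyHullCompact_inter_sublevel hCs
        (MvPolynomial.C (c⁻¹ : ℂ) * MvPolynomial.X i) (fun w hw hwi => by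
          rw [hφ, inv_mul_eq_one₀ hc.ne'] at hwi
          refine ⟨h w (polyHullCompact_mono_s9 hC inter_subset_left hw)
            (hwi.trans_le (norm_le_pi_norm w i)), fun j hj => ?_⟩
          exact norm_apply_le_of_mem_polyHullCompact hw hc.le fun v hv => hv.2 j hj) ih
        (by
          rw [hφ, inv_mul_le_iff₀ hc, mul_one]
          exact (norm_le_pi_norm z i).trans hzc)
      convert hstep using 2
      ext w
      simp only [hφ, inv_mul_le_iff₀ hc, mul_one, mem_inter_iff, mem_ofPred_eq,
        Finset.forall_mem_insert]
      tauto
  convert key Finset.univ using 2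
  ext w
  simp [pi_norm_le_iff_of_nonneg hc.le]

theorem polyHullCompact_subset_polyHull (hC : IsCompact C) (h : C ⊆ X) :
    polyHullCompact C ⊆ polyHull X :=
  subset_biUnion_of_mem (u := polyHullCompact) (show C ∈ {C | IsCompact C ∧ C ⊆ X} from ⟨hC, h⟩)

theorem mem_polyHull : z ∈ polyHull X ↔ ∃ C, IsCompact C ∧ C ⊆ X ∧ z ∈ polyHullCompact C := by
  simp [polyHull, and_assoc]

/-- If `h(X)` is bounded, then it is contained in the hull of a compact part of `X`. -/
theorem exists_hHull_subset_polyHullCompact (hX : IsClosed X)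
    (hb : Bornology.IsBounded (hHull X)) :
    ∃ c : ℝ, hHull X ⊆ polyHullCompact (X ∩ Metric.closedBall 0 c) := by
  obtain ⟨R, hR, hXR⟩ := hb.exists_pos_norm_le
  have hcomp : ∀ ρ : ℝ, IsCompact (X ∩ Metric.closedBall 0 ρ) := fun ρ =>
    (isCompact_closedBall _ _).inter_left hX
  refine ⟨R + 1, fun z hz => ?_⟩
  obtain ⟨C, hC, hCX, hzC⟩ := mem_polyHull.1 hz.1
  obtain ⟨ρ, hρ, hCρ⟩ := hC.isBounded.exists_pos_norm_le
  have hCsub : C ⊆ X ∩ Metric.closedBall 0 ρ := fun w hw => ⟨hCX hw, by simpa using hCρ w hw⟩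
  refine polyHullCompact_mono_s9 (hcomp _) (inter_subset_inter_left _ inter_subset_left)
    (mem_polyHullCompact_inter_closedBall (hcomp ρ) (by positivity) (fun w hw hwR => ⟨?_, ?_⟩)
      (polyHullCompact_mono_s9 (hcomp ρ) hCsub hzC) ((hXR z hz).trans (by linarith)))
  · by_contra hwX
    have := hXR w ⟨polyHullCompact_subset_polyHull (hcomp ρ) inter_subset_left hw, hwX⟩
    linarith
  · simpa using norm_le_of_mem_polyHullCompact_s9 hw hρ.le fun v hv => by simpa using hv.2

theorem HasBoundedEHulls.exists_isCompact_isPolyConvex {M : Set (Fin n → ℂ)}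
    (hBE : HasBoundedEHulls M) (hM : IsClosed M) (hC : IsCompact C) :
    ∃ K, IsCompact K ∧ C ⊆ K ∧ IsPolyConvex (K ∪ M) := by
  set X := C ∪ M with hXdef
  have hX : IsClosed X := hC.isClosed.union hM
  have hcomp : ∀ ρ : ℝ, IsCompact (X ∩ Metric.closedBall 0 ρ) := fun ρ =>
    (isCompact_closedBall _ _).inter_left hX
  obtain ⟨c, hc⟩ := exists_hHull_subset_polyHullCompact hX (hBE C hC)
  refine ⟨C ∪ polyHullCompact (X ∩ Metric.closedBall 0 c),
    hC.union (isCompact_polyHullCompact_s9 (hcomp c)), subset_union_left, ?_⟩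
  rw [union_right_comm]
  refine sdiff_eq_empty.2 fun z hz => ?_
  obtain ⟨D, hD, hDX, hzD⟩ := mem_polyHull.1 hz
  obtain ⟨ρ, hρ, hDρ⟩ := hD.isBounded.exists_pos_norm_le
  have hDsub : D ⊆ polyHullCompact (X ∩ Metric.closedBall 0 (max ρ c)) := by
    intro w hw
    rcases hDX hw with h | h
    · exact subset_polyHullCompact_s9 (hcomp _)
        ⟨h, by simpa using (hDρ w hw).trans (le_max_left ρ c)⟩
    · exact polyHullCompact_mono_s9 (hcomp _)
        (inter_subset_inter_right _ (Metric.closedBall_subset_closedBall (le_max_right ρ c))) h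
  have hzX : z ∈ polyHull X := polyHullCompact_subset_polyHull (hcomp _) inter_subset_left
    (polyHullCompact_subset_of_subset (hcomp _) hDsub hzD)
  by_cases h : z ∈ X
  · exact Or.inl h
  · exact Or.inr (hc ⟨hzX, h⟩)

end Hull

/-- a closed set with bounded E-hulls admits a normal exhaustion `K_j` of `ℂⁿ`
with each `K_j ∪ M` polynomially convex. -/
theorem exists_normal_exhaustion_polyConvex {n : ℕ}
    (M : Set (Fin n → ℂ)) (hMclosed : IsClosed M) (hBE : HasBoundedEHulls M) :
    ∃ K : ℕ → Set (Fin n → ℂ),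
      (∀ j, IsCompact (K j)) ∧
      (∀ j, K j ⊆ interior (K (j + 1))) ∧
      (⋃ j, K j) = Set.univ ∧
      (∀ j, IsPolyConvex (K j ∪ M)) := by
  choose! F hFc hFsub hFconv using fun (C : Set (Fin n → ℂ)) (hC : IsCompact C) =>
    hBE.exists_isCompact_isPolyConvex hMclosed hC
  let G : ℕ → Set (Fin n → ℂ) → Set (Fin n → ℂ) := fun j P =>
    Metric.cthickening 1 P ∪ Metric.closedBall 0 j
  have hG : ∀ j P, IsCompact P → IsCompact (G j P) := fun j P hP =>
    hP.cthickening.union (isCompact_closedBall _ _)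
  let K : ℕ → Set (Fin n → ℂ) := fun j => Nat.rec (F ∅) (fun j P => F (G j P)) j
  have hKc : ∀ j, IsCompact (K j) := fun j => by
    induction j with
    | zero => exact hFc _ isCompact_empty
    | succ j ih => exact hFc _ (hG j _ ih)
  have hGK : ∀ j, G j (K j) ⊆ K (j + 1) := fun j => hFsub _ (hG j _ (hKc j))
  refine ⟨K, hKc, fun j => ?_, eq_univ_of_forall fun z => ?_, fun j => ?_⟩
  · exact (Metric.self_subset_thickening one_pos _).trans
      ((Metric.thickening_subset_interior_cthickening 1 _).trans
        (interior_mono (subset_union_left.trans (hGK j))))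
  · obtain ⟨j, hj⟩ := exists_nat_ge ‖z‖
    exact mem_iUnion.2 ⟨j + 1, hGK j (Or.inr (by simpa using hj))⟩
  · cases j with
    | zero => exact hFconv _ isCompact_empty
    | succ j => exact hFconv _ (hG j _ (hKc j))
end
end
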